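/- arXiv:1508.03691 — 3 statements merged into one kernel-verified Lean document; each statement's English description precedes it below -/
import Mathlib

section
/- Let P, Q, R be finite posets and let F : P → Q and G : Q → R be measurable maps (preimages of upper sets are upper sets and preimages of lower sets are lower sets). For each subset S of P let I^P_S be a ℚ-linear map from functions P → ℚ to ℚ with I^P_S(1_T) = χ_P(T) for every subset T ⊆ S that is an upper set of the subposet S, and define I^Q_S for subsets S of Q analogously using χ_Q. Define the pushforwards F_*f(d) = I^P_{F⁻¹({q ≤ d})}(f·1_{F⁻¹({q ≤ d})}) for f : P → ℚ and d ∈ Q, G_*g(e) = I^Q_{G⁻¹({r ≤ e})}(g·1_{G⁻¹({r ≤ e})}) for g : Q → ℚ and e ∈ R, and (G∘F)_*f(e) = I^P_{(G∘F)⁻¹({r ≤ e})}(f·1_{(G∘F)⁻¹({r ≤ e})}). Then for every f : P → ℚ and every e ∈ R, (G∘F)_*f(e) = G_*(F_*f)(e); that is, the pushforward is compatible with composition. -/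
open scoped Classical

/-- The weighting of a subset `S` of a finite poset: vanishes outside `S` and
satisfies `∑_{b ∈ S, a ≤ b} w b = 1` for every `a ∈ S`. -/
def IsPosetWeighting (P : Type*) [PartialOrder P] [Fintype P]
    (S : Set P) (w : P → ℚ) : Prop :=
  (∀ x : P, x ∉ S → w x = 0) ∧
  ∀ a ∈ S, (∑ b : P, if b ∈ S ∧ a ≤ b then w b else 0) = 1

/-- `T` is an upper set of the subposet on `S`. -/
def UpperIn (P : Type*) [PartialOrder P] (S T : Set P) : Prop :=
  T ⊆ S ∧ ∀ x ∈ T, ∀ y ∈ S, x ≤ y → y ∈ T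

/-- A map of posets is measurable if preimages of upper sets are upper sets and
preimages of lower sets are lower sets. -/
def PosetMeasurable {P Q : Type*} [PartialOrder P] [PartialOrder Q] (F : P → Q) : Prop :=
  (∀ S : Set Q, IsUpperSet S → IsUpperSet (F ⁻¹' S)) ∧
  (∀ S : Set Q, IsLowerSet S → IsLowerSet (F ⁻¹' S))

theorem PosetMeasurable.monotone {P Q : Type*} [PartialOrder P] [PartialOrder Q] {F : P → Q}
    (hF : PosetMeasurable F) : Monotone F := fun _ y hxy =>
  hF.2 (Set.Iic (F y)) (isLowerSet_Iic _) hxy (le_refl (F y))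

/-- A set with a least element has Euler characteristic `1`. -/
theorem IsPosetWeighting.sum_eq_one_of_isLeast {P : Type*} [PartialOrder P] [Fintype P]
    {S : Set P} {w : P → ℚ} (hw : IsPosetWeighting P S w) {p : P} (hp : IsLeast S p) :
    (∑ b : P, if b ∈ S then w b else 0) = 1 := by
  rw [← hw.2 p hp.1]
  refine Finset.sum_congr rfl fun b _ => ?_
  by_cases hb : b ∈ S
  · simp [hb, hp.2 hb]
  · simp [hb]

/-- The indicator functions of principal upper sets span all functions on a finite poset. -/
theorem span_indicator_Ici_eq_top (P : Type*) [PartialOrder P] [Finite P] :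
    Submodule.span ℚ (Set.range fun p : P => (Set.Ici p).indicator (1 : P → ℚ)) = ⊤ := by
  have := Fintype.ofFinite P
  have h : ∀ p : P, (Pi.single p 1 : P → ℚ) ∈
      Submodule.span ℚ (Set.range fun p : P => (Set.Ici p).indicator (1 : P → ℚ)) := by
    intro p
    induction p using WellFoundedGT.induction with
    | ind p ih =>
      have hp : (Pi.single p 1 : P → ℚ) = (Set.Ici p).indicator (1 : P → ℚ) -
          ∑ q ∈ Finset.univ.filter (p < ·), Pi.single q 1 := by
        ext x
        simp only [Pi.sub_apply, Finset.sum_apply, Set.indicator_apply, Set.mem_Ici,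
          Pi.single_apply, Finset.sum_ite_eq, Finset.mem_filter, Finset.mem_univ, true_and,
          Pi.one_apply]
        rcases eq_or_ne x p with rfl | hx
        · simp
        · simp [hx, lt_iff_le_and_ne, hx.symm]
      rw [hp]
      exact Submodule.sub_mem _ (Submodule.subset_span ⟨p, rfl⟩)
        (Submodule.sum_mem _ fun q hq => ih q (Finset.mem_filter.1 hq).2)
  rw [eq_top_iff, ← (Pi.basisFun ℚ P).span_eq, Submodule.span_le]
  rintro _ ⟨p, rfl⟩
  simpa using h p

/-- Clipping a function to a set, as a linear map. -/
noncomputable def clipLinearMap {P : Type*} (S : Set P) : (P → ℚ) →ₗ[ℚ] (P → ℚ) where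
  toFun f := S.indicator f
  map_add' f g := Set.indicator_add S f g
  map_smul' c f := Set.indicator_const_smul S c f

/-- The pushforward along `F` of integration against a family of functionals `I`. -/
noncomputable def pushforwardLinearMap {P Q : Type*} [PartialOrder Q]
    (I : Set P → ((P → ℚ) →ₗ[ℚ] ℚ)) (F : P → Q) : (P → ℚ) →ₗ[ℚ] (Q → ℚ) :=
  LinearMap.pi fun d => I (F ⁻¹' Set.Iic d) ∘ₗ clipLinearMap (F ⁻¹' Set.Iic d)

theorem pushforwardLinearMap_apply {P Q : Type*} [PartialOrder Q]
    (I : Set P → ((P → ℚ) →ₗ[ℚ] ℚ)) (F : P → Q) (f : P → ℚ) (d : Q) :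
    pushforwardLinearMap I F f d = I (F ⁻¹' Set.Iic d) ((F ⁻¹' Set.Iic d).indicator f) :=
  rfl

/-- The pushforward along a monotone map sends the indicator of a principal upper set to the
indicator of the principal upper set of the image. -/
theorem pushforwardLinearMap_indicator_Ici {P Q : Type*} [PartialOrder P] [PartialOrder Q]
    [Fintype P] {χ : Set P → ℚ}
    (hχ : ∀ S : Set P,
      ∃ w : P → ℚ, IsPosetWeighting P S w ∧ χ S = ∑ b : P, if b ∈ S then w b else 0)
    {I : Set P → ((P → ℚ) →ₗ[ℚ] ℚ)}
    (hI : ∀ S T : Set P, UpperIn P S T → I S (fun x => if x ∈ T then 1 else 0) = χ T)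
    {F : P → Q} (hF : Monotone F) (p : P) :
    pushforwardLinearMap I F ((Set.Ici p).indicator 1) = (Set.Ici (F p)).indicator 1 := by
  have hI' : ∀ S T : Set P, UpperIn P S T → I S (T.indicator 1) = χ T := fun S T hT => by
    rw [← hI S T hT]
    congr 1
  ext d
  rw [pushforwardLinearMap_apply, Set.indicator_indicator]
  by_cases hd : F p ≤ d
  · have hT : UpperIn P (F ⁻¹' Set.Iic d) (F ⁻¹' Set.Iic d ∩ Set.Ici p) :=
      ⟨Set.inter_subset_left, fun x hx y hy hxy => ⟨hy, le_trans hx.2 hxy⟩⟩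
    obtain ⟨w, hw, hχw⟩ := hχ (F ⁻¹' Set.Iic d ∩ Set.Ici p)
    rw [Set.indicator_of_mem (show d ∈ Set.Ici (F p) from hd), hI' _ _ hT, hχw,
      hw.sum_eq_one_of_isLeast ⟨⟨hd, le_refl p⟩, fun x hx => hx.2⟩, Pi.one_apply]
  · have hempty : F ⁻¹' Set.Iic d ∩ Set.Ici p = ∅ :=
      Set.eq_empty_of_forall_notMem fun x hx => hd ((hF hx.2).trans hx.1)
    rw [hempty, Set.indicator_empty, Set.indicator_of_notMem (show d ∉ Set.Ici (F p) from hd)]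
    exact map_zero _

/-- The pushforward of Euler integration along measurable maps
of finite posets is compatible with composition: `(G ∘ F)_* f = G_* (F_* f)`. -/
theorem pushforward_comp
    (P Q R : Type*) [PartialOrder P] [PartialOrder Q] [PartialOrder R]
    [Fintype P] [Fintype Q] [Fintype R]
    (χP : Set P → ℚ)
    (hχP : ∀ S : Set P,
      ∃ w : P → ℚ, IsPosetWeighting P S w ∧ χP S = ∑ b : P, if b ∈ S then w b else 0)
    (χQ : Set Q → ℚ)
    (hχQ : ∀ S : Set Q,
      ∃ w : Q → ℚ, IsPosetWeighting Q S w ∧ χQ S = ∑ b : Q, if b ∈ S then w b else 0)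
    (IP : Set P → ((P → ℚ) →ₗ[ℚ] ℚ))
    (hIP : ∀ S T : Set P, UpperIn P S T →
      IP S (fun x => if x ∈ T then 1 else 0) = χP T)
    (IQ : Set Q → ((Q → ℚ) →ₗ[ℚ] ℚ))
    (hIQ : ∀ S T : Set Q, UpperIn Q S T →
      IQ S (fun x => if x ∈ T then 1 else 0) = χQ T)
    (F : P → Q) (G : Q → R)
    (hF : PosetMeasurable F) (hG : PosetMeasurable G)
    (f : P → ℚ) (e : R) :
    IP ((fun p => G (F p)) ⁻¹' {r : R | r ≤ e})
        (fun p => if p ∈ (fun p => G (F p)) ⁻¹' {r : R | r ≤ e} then f p else 0) =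
      IQ (G ⁻¹' {r : R | r ≤ e})
        (fun d => if d ∈ G ⁻¹' {r : R | r ≤ e} then
          IP (F ⁻¹' {q : Q | q ≤ d})
            (fun p => if p ∈ F ⁻¹' {q : Q | q ≤ d} then f p else 0)
          else 0) := by
  have key : pushforwardLinearMap IP (G ∘ F) =
      pushforwardLinearMap IQ G ∘ₗ pushforwardLinearMap IP F := by
    refine LinearMap.ext_on_range (span_indicator_Ici_eq_top P) fun p => ?_
    rw [LinearMap.comp_apply,
      pushforwardLinearMap_indicator_Ici hχP hIP (hG.monotone.comp hF.monotone),
      pushforwardLinearMap_indicator_Ici hχP hIP hF.monotone,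
      pushforwardLinearMap_indicator_Ici hχQ hIQ hG.monotone, Function.comp_apply]
  exact congrFun (LinearMap.congr_fun key f) e
end

section
/- Let P be a finite poset, a ∈ P, and let I be a ℚ-linear map from functions P → ℚ to ℚ such that I(1_T) = χ(T) for every subset T of the principal lower set {x ∈ P | x ≤ a} that is an upper set of the subposet {x ∈ P | x ≤ a}. Then for every function f : P → ℚ, I(f·1_{{x | x ≤ a}}) = f(a); that is, the Euler integration of f over the principal lower set generated by a equals f(a) (equivalently, the pushforward along the identity map is the identity). -/
open scoped Classical

/-- A weighting on a set with a greatest element vanishes away from that element. -/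
theorem IsPosetWeighting.eq_zero_of_isGreatest {P : Type*} [PartialOrder P] [Fintype P]
    {S : Set P} {w : P → ℚ} {a : P} (hw : IsPosetWeighting P S w) (ha : IsGreatest S a)
    (x : P) (hx : x ≠ a) : w x = 0 := by
  have hwa : w a = 1 := by
    rw [← hw.2 a ha.1, Finset.sum_eq_single a]
    · simp [ha.1]
    · exact fun b _ hb => if_neg fun h => hb (le_antisymm (ha.2 h.1) h.2)
    · simp
  induction x using WellFoundedGT.induction with
  | ind x ih =>
    by_cases hxS : x ∈ S
    · have h := hw.2 x hxS
      rw [Finset.sum_eq_add x a hx, if_pos ⟨hxS, le_rfl⟩, if_pos ⟨ha.1, ha.2 hxS⟩, hwa] at h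
      · linarith
      · rintro b - ⟨hbx, hba⟩
        split_ifs with hb
        · exact ih b (lt_of_le_of_ne hb.2 hbx.symm) hba
        · rfl
      · simp
      · simp
    · exact hw.1 x hxS

/-- A weighting on a set with a greatest element has total mass one. -/
theorem IsPosetWeighting.sum_eq_one_of_isGreatest {P : Type*} [PartialOrder P] [Fintype P]
    {S : Set P} {w : P → ℚ} {a : P} (hw : IsPosetWeighting P S w) (ha : IsGreatest S a) :
    (∑ b : P, if b ∈ S then w b else 0) = 1 := by
  rw [← hw.2 a ha.1]
  refine Finset.sum_congr rfl fun b _ => ?_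
  by_cases hb : b = a
  · simp [hb]
  · simp [hw.eq_zero_of_isGreatest ha b hb]

/-- The Euler integration of a function over the principal
lower set generated by `a` equals its value at `a`. -/
theorem euler_integration_over_principal_lower_set
    (P : Type*) [PartialOrder P] [Fintype P] (a : P)
    (χ : Set P → ℚ)
    (hχ : ∀ S : Set P,
      ∃ w : P → ℚ, IsPosetWeighting P S w ∧ χ S = ∑ b : P, if b ∈ S then w b else 0)
    (I : (P → ℚ) →ₗ[ℚ] ℚ)
    (hI : ∀ T : Set P, UpperIn P {x : P | x ≤ a} T →
      I (fun x => if x ∈ T then 1 else 0) = χ T)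
    (f : P → ℚ) :
    I (fun x => if x ≤ a then f x else 0) = f a := by
  have hone : ∀ T : Set P, IsGreatest T a → χ T = 1 := by
    intro T hT
    obtain ⟨w, hw, h⟩ := hχ T
    rw [h, hw.sum_eq_one_of_isGreatest hT]
  have hempty : χ ∅ = 0 := by
    obtain ⟨w, -, h⟩ := hχ ∅
    simpa using h
  have hindicator : ∀ T : Set P, UpperIn P {x : P | x ≤ a} T →
      I (T.indicator 1) = χ T := by
    intro T hT
    rw [← hI T hT]
    congr 1
  have hsingle : ∀ x ≤ a, I (fun y => if x = y then 1 else 0) = if x = a then 1 else 0 := by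
    intro x hx
    have hdiff : (fun y => if x = y then 1 else 0 : P → ℚ) =
        (Set.Icc x a).indicator 1 - (Set.Ioc x a).indicator 1 := by
      ext y
      by_cases hy : x = y
      · subst hy
        simp [hx]
      · simp [hy, Set.indicator_apply, lt_iff_le_and_ne]
    have hIcc : UpperIn P {x : P | x ≤ a} (Set.Icc x a) :=
      ⟨fun _ hy => hy.2, fun _ hy _ hz hyz => ⟨hy.1.trans hyz, hz⟩⟩
    have hIoc : UpperIn P {x : P | x ≤ a} (Set.Ioc x a) :=
      ⟨fun _ hy => hy.2, fun _ hy _ hz hyz => ⟨hy.1.trans_le hyz, hz⟩⟩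
    rw [hdiff, map_sub, hindicator _ hIcc, hindicator _ hIoc, hone _ (isGreatest_Icc hx)]
    split_ifs with hxa
    · rw [hxa, Set.Ioc_self, hempty, sub_zero]
    · rw [hone _ (isGreatest_Ioc (lt_of_le_of_ne hx hxa)), sub_self]
  rw [LinearMap.pi_apply_eq_sum_univ I, Finset.sum_eq_single a]
  · rw [hsingle a le_rfl]
    simp
  · intro x _ hxa
    split_ifs with hx
    · rw [hsingle x hx, if_neg hxa, smul_zero]
    · rw [zero_smul]
  · simp
end

section
/- Let P be a finite poset (a one-way network), T a finite set of targets, and q : T → P an assignment of a node q(t) to each target t (the node at or directly above the line on which t lies). Define the counting function h : P → ℚ by h(p) = card{t ∈ T | q(t) ≤ p}. Let I be a ℚ-linear map from functions P → ℚ to ℚ such that I(1_A) = χ(A) for every upper set A of P. Then I(h) = card T; that is, the number of targets equals the Euler integration of the counting function: T^♯ = ∫_P h dχ. -/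
open scoped Classical

/-- The weights on a principal upper set sum to one. -/
theorem IsPosetWeighting.sum_Ici {P : Type*} [PartialOrder P] [Fintype P] {a : P} {w : P → ℚ}
    (hw : IsPosetWeighting P (Set.Ici a) w) :
    (∑ b : P, if a ≤ b then w b else 0) = 1 := by
  simpa using hw.2 a Set.self_mem_Ici

/-- Target enumeration on a one-way network: the number of
targets equals the Euler integration of the counting function
`h p = #{t | q t ≤ p}`. -/
theorem target_count_eq_euler_integration
    (P : Type*) [PartialOrder P] [Fintype P]
    (T : Type*) [Fintype T] (q : T → P)
    (χ : Set P → ℚ)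
    (hχ : ∀ S : Set P,
      ∃ w : P → ℚ, IsPosetWeighting P S w ∧ χ S = ∑ b : P, if b ∈ S then w b else 0)
    (I : (P → ℚ) →ₗ[ℚ] ℚ)
    (hI : ∀ A : Set P, IsUpperSet A → I (fun p => if p ∈ A then 1 else 0) = χ A)
    (h : P → ℚ) (hh : ∀ p : P, h p = Fintype.card {t : T // q t ≤ p}) :
    I h = Fintype.card T := by
  have key (t : T) : I (fun p => if q t ≤ p then 1 else 0) = 1 := by
    obtain ⟨w, hw, hχw⟩ := hχ (Set.Ici (q t))
    have hIw := hI _ (isUpperSet_Ici (q t))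
    simp only [Set.mem_Ici] at hIw hχw
    rw [hIw, hχw, hw.sum_Ici]
  have h_sum : h = ∑ t : T, fun p => if q t ≤ p then (1 : ℚ) else 0 := by
    ext p
    simp [hh, Fintype.card_subtype]
  rw [h_sum, map_sum, Finset.sum_congr rfl fun t _ => key t]
  simp
end
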